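/- arXiv:1703.04736 — 9 statements merged into one kernel-verified Lean document; each statement's English description precedes it below -/
import Mathlib

section
/- (Myhill–Nerode theorem for trees) For every regular tree language L ⊆ Trees(Σ) there exists a finite algebra which recognises L and which divides every other algebra recognising L; namely, the quotient of the algebra Trees(Σ) by the syntactic congruence of L has this property. -/
set_option autoImplicit false

/-! ## Trees over a ranked alphabet -/

/-- Trees over a ranked alphabet: a type `S` of letters together with an arity
function `ar : S → ℕ`; a node labelled `a` has exactly `ar a` (ordered) children. -/
inductive RTree (S : Type) (ar : S → ℕ) : Type where
  | node (a : S) (children : Fin (ar a) → RTree S ar) : RTree S ar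

/-! ## Algebras -/

/-- An (unindexed) algebra structure on a carrier `α`: for every arity `n`,
a set of `n`-ary operations on `α`. -/
structure AlgStr (α : Type) where
  ops : (n : ℕ) → Set ((Fin n → α) → α)

/-- A finite algebra: finite carrier and finitely many operations. -/
def FiniteAlg {α : Type} (A : AlgStr α) : Prop :=
  Finite α ∧ Finite ((n : ℕ) × {f : (Fin n → α) → α // f ∈ A.ops n})

/-- `h : Trees(Σ) → α` is a homomorphism into the algebra `A`:
for every letter there is an operation of `A` (of the right arity) commuting with `h`. -/
def IsHom {S : Type} {ar : S → ℕ} {α : Type} (A : AlgStr α) (h : RTree S ar → α) : Prop :=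
  ∀ a : S, ∃ f ∈ A.ops (ar a), ∀ ts : Fin (ar a) → RTree S ar,
    h (RTree.node a ts) = f (fun i => h (ts i))

/-- A tree language is recognised by an algebra if it is the preimage of a subset of
the carrier under some homomorphism into the algebra. -/
def Recognises {S : Type} {ar : S → ℕ} {α : Type} (A : AlgStr α) (L : Set (RTree S ar)) : Prop :=
  ∃ h : RTree S ar → α, IsHom A h ∧ ∃ F : Set α, L = h ⁻¹' F

/-- A tree language is regular if it is recognised by some finite algebra. -/
def TreeRegular {S : Type} {ar : S → ℕ} (L : Set (RTree S ar)) : Prop :=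
  ∃ (α : Type) (A : AlgStr α), FiniteAlg A ∧ Recognises A L

/-! ## Contexts, derivatives and the syntactic congruence -/

/-- A context: a term over `Σ` with exactly one occurrence of the hole variable. -/
inductive TCtx (S : Type) (ar : S → ℕ) : Type where
  | hole : TCtx S ar
  | node (a : S) (i : Fin (ar a)) (c : TCtx S ar)
      (other : (j : Fin (ar a)) → j ≠ i → RTree S ar) : TCtx S ar

/-- Substituting a tree for the hole of a context. -/
def TCtx.plug {S : Type} {ar : S → ℕ} : TCtx S ar → RTree S ar → RTree S ar
  | .hole, t => t
  | .node a i c other, t => RTree.node a (fun j => if h : j = i then c.plug t else other j h)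

/-- `D` is a derivative of `L`: `D = {t : p[t] ∈ L}` for some context `p`. -/
def IsDerivative {S : Type} {ar : S → ℕ} (L D : Set (RTree S ar)) : Prop :=
  ∃ p : TCtx S ar, D = {t | p.plug t ∈ L}

/-- The syntactic congruence relation of `L`: `t` and `t'` belong to exactly the same
derivatives of `L`. -/
def synRel {S : Type} {ar : S → ℕ} (L : Set (RTree S ar)) (t t' : RTree S ar) : Prop :=
  ∀ p : TCtx S ar, p.plug t ∈ L ↔ p.plug t' ∈ L

/-- The syntactic congruence of `L`, as a setoid. -/
def synSetoid {S : Type} {ar : S → ℕ} (L : Set (RTree S ar)) : Setoid (RTree S ar) :=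
  ⟨synRel L, ⟨fun _ _ => Iff.rfl, fun h p => (h p).symm, fun h h' p => (h p).trans (h' p)⟩⟩

/-- The syntactic algebra of `L`: the quotient of the tree algebra by the syntactic
congruence, with the operations induced by the tree-building operations. -/
def synAlg {S : Type} {ar : S → ℕ} (L : Set (RTree S ar)) :
    AlgStr (Quotient (synSetoid L)) where
  ops n := { g | ∃ (a : S) (h : ar a = n), ∀ us : Fin n → RTree S ar,
      g (fun i => Quotient.mk (synSetoid L) (us i))
        = Quotient.mk (synSetoid L) (RTree.node a (fun j => us (Fin.cast h j))) }

/-- The syntactic homomorphism: the quotient map onto the syntactic algebra. -/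
def synMap {S : Type} {ar : S → ℕ} (L : Set (RTree S ar)) (t : RTree S ar) :
    Quotient (synSetoid L) :=
  Quotient.mk (synSetoid L) t

/-! ## Boolean combinations -/

/-- Finite Boolean combinations of sets from a family `G`. -/
inductive BoolComb {X : Type} (G : Set (Set X)) : Set X → Prop where
  | base {s : Set X} : s ∈ G → BoolComb G s
  | compl {s : Set X} : BoolComb G s → BoolComb G sᶜ
  | union {s t : Set X} : BoolComb G s → BoolComb G t → BoolComb G (s ∪ t)
  | inter {s t : Set X} : BoolComb G s → BoolComb G t → BoolComb G (s ∩ t)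

/-! ## Polynomial operations and the matrix power -/

/-- Terms built from the operations of `A`, variables (among `m` of them) and
constants for elements of the carrier. -/
inductive PolyTerm {α : Type} (A : AlgStr α) (m : ℕ) : Type where
  | var (i : Fin m)
  | const (c : α)
  | app (n : ℕ) (f : (Fin n → α) → α) (hf : f ∈ A.ops n) (args : Fin n → PolyTerm A m)

/-- Evaluation of a polynomial term under a valuation of the variables. -/
def PolyTerm.eval {α : Type} {A : AlgStr α} {m : ℕ} : PolyTerm A m → (Fin m → α) → α
  | .var i, xs => xs i
  | .const c, _ => c
  | .app _ f _ args, xs => f (fun j => (args j).eval xs)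

/-- `Pol A m`: the `m`-ary polynomial operations of `A`. -/
def Pol {α : Type} (A : AlgStr α) (m : ℕ) : Set ((Fin m → α) → α) :=
  { g | ∃ p : PolyTerm A m, ∀ xs, g xs = p.eval xs }

/-- The algebra on the same carrier whose operations are all polynomial operations of `A`. -/
def polAlg {α : Type} (A : AlgStr α) : AlgStr α :=
  ⟨fun n => Pol A n⟩

/-- Concatenation of `k` many `n`-tuples into one `n·k`-tuple. -/
def concatTuples {α : Type} (n k : ℕ) (as : Fin k → Fin n → α) : Fin (n * k) → α :=
  fun j => as (finProdFinEquiv.symm j).2 (finProdFinEquiv.symm j).1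

/-- The `n`-th matrix power of `A`: carrier `αⁿ`, and the `k`-ary operations are exactly
those given coordinatewise by `n`-tuples of `n·k`-ary polynomial operations of `A`
applied to the concatenation of the `k` argument `n`-tuples. -/
def matrixPower {α : Type} (A : AlgStr α) (n : ℕ) : AlgStr (Fin n → α) where
  ops k := { G | ∃ fs : Fin n → ((Fin (n * k) → α) → α),
      (∀ i, fs i ∈ Pol A (n * k)) ∧
      ∀ as : Fin k → Fin n → α, G as = fun i => fs i (concatTuples n k as) }

/-! ## Division of algebras -/

/-- `A` divides `B`: `A` is (isomorphic to) a quotient of a subalgebra of a reduct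
of `B`. Concretely: there is a subset of the carrier of `B` and a surjection `φ` onto
the carrier of `A` such that every operation of `A` is induced via `φ` by some
operation of `B` under which the subset is closed. -/
def Divides {α β : Type} (A : AlgStr α) (B : AlgStr β) : Prop :=
  ∃ (C : Set β) (φ : C → α), Function.Surjective φ ∧
    ∀ n : ℕ, ∀ f ∈ A.ops n, ∃ g ∈ B.ops n,
      ∃ hcl : ∀ xs : Fin n → C, g (fun i => (xs i).1) ∈ C,
        ∀ xs : Fin n → C, φ ⟨g (fun i => (xs i).1), hcl xs⟩ = f (fun i => φ (xs i))

/-! ## Terms, tree homomorphisms and top-down transducers -/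

/-- Terms over a ranked alphabet `(G, arG)` with variables from `X`. -/
inductive TTerm (G : Type) (arG : G → ℕ) (X : Type) : Type where
  | var (x : X)
  | node (b : G) (ts : Fin (arG b) → TTerm G arG X)

/-- Substituting trees for the variables of a term. -/
def TTerm.subst {G : Type} {arG : G → ℕ} {X : Type} (σ : X → RTree G arG) :
    TTerm G arG X → RTree G arG
  | .var x => σ x
  | .node b ts => RTree.node b (fun i => (ts i).subst σ)

/-- A tree homomorphism datum: a term `t_a` over `Γ` with `ar a` variables for each `a ∈ Σ`. -/
def TreeHomData (S : Type) (arS : S → ℕ) (G : Type) (arG : G → ℕ) : Type :=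
  (a : S) → TTerm G arG (Fin (arS a))

/-- Applying a tree homomorphism: recursively replace each node labelled `a`
by the term `t_a` applied to the images of its subtrees. -/
def applyTreeHom {S : Type} {arS : S → ℕ} {G : Type} {arG : G → ℕ}
    (θ : TreeHomData S arS G arG) : RTree S arS → RTree G arG
  | .node a ts => (θ a).subst (fun i => applyTreeHom θ (ts i))

/-- A relabeling: an arity-preserving map of alphabets, lifted to trees. -/
def relabelMap {S S' : Type} {ar : S → ℕ} {ar' : S' → ℕ}
    (f : S' → S) (hf : ∀ a, ar' a = ar (f a)) : RTree S' ar' → RTree S ar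
  | .node a ts => RTree.node (f a) (fun i => relabelMap f hf (ts (Fin.cast (hf a).symm i)))

/-- A deterministic top-down tree transducer with input alphabet `(S, arS)`,
output alphabet `(G, arG)` and states `Q`. -/
structure DTOP (S : Type) (arS : S → ℕ) (G : Type) (arG : G → ℕ) (Q : Type) where
  init : Q
  δ : (a : S) → Q → TTerm G arG (Q × Fin (arS a))

/-- The semantics of a dtop, parametrised by the state it is started in. -/
def DTOP.run {S : Type} {arS : S → ℕ} {G : Type} {arG : G → ℕ} {Q : Type}
    (d : DTOP S arS G arG Q) : RTree S arS → Q → RTree G arG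
  | .node a ts => fun q => (d.δ a q).subst (fun p => d.run (ts p.2) p.1)

/-! ## Path languages -/

/-- The path alphabet `[Σ]`: leaf letters, and pairs (letter, child number). -/
def PathLetter (S : Type) (ar : S → ℕ) : Type :=
  {a : S // ar a = 0} ⊕ ((a : S) × Fin (ar a))

/-- `IsPathWord t w`: `w` is the word over `[Σ]` determined by some root-to-leaf
path of `t`. -/
inductive IsPathWord {S : Type} {ar : S → ℕ} : RTree S ar → List (PathLetter S ar) → Prop where
  | leaf (a : S) (h : ar a = 0) (ts : Fin (ar a) → RTree S ar) :
      IsPathWord (RTree.node a ts) [Sum.inl ⟨a, h⟩]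
  | step (a : S) (ts : Fin (ar a) → RTree S ar) (i : Fin (ar a))
      (w : List (PathLetter S ar)) :
      IsPathWord (ts i) w → IsPathWord (RTree.node a ts) (Sum.inr ⟨a, i⟩ :: w)

/-- A regular word language: one accepted by a DFA with finitely many states. -/
def RegularWordLang {A : Type} (W : Set (List A)) : Prop :=
  ∃ (Q : Type) (_ : Finite Q) (M : DFA A Q), ∀ w, w ∈ W ↔ w ∈ M.accepts

/-- `AW W`: the trees all of whose root-to-leaf path words belong to `W`. -/
def AW {S : Type} {ar : S → ℕ} (W : Set (List (PathLetter S ar))) : Set (RTree S ar) :=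
  { t | ∀ w, IsPathWord t w → w ∈ W }

/-- A universal path language: `AW W` for some regular word language `W`. -/
def IsUniversalPathLang {S : Type} {ar : S → ℕ} (L : Set (RTree S ar)) : Prop :=
  ∃ W : Set (List (PathLetter S ar)), RegularWordLang W ∧ L = AW W

/-- The set of path words of trees in `L`. -/
def pathWordsOf {S : Type} {ar : S → ℕ} (L : Set (RTree S ar)) :
    Set (List (PathLetter S ar)) :=
  { w | ∃ t ∈ L, IsPathWord t w }

/-! ## Some concrete algebras and the Boolean alphabet -/

/-- The two-element semi-lattice `(2, ∧)`. -/
def semilatticeAlg : AlgStr Bool where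
  ops n := match n with
    | 2 => {fun v => v 0 && v 1}
    | _ => ∅

/-- The semi-lattice with constants, `(2, ∧, 0, 1)`. -/
def semilattice01Alg : AlgStr Bool where
  ops n := match n with
    | 2 => {fun v => v 0 && v 1}
    | 0 => {fun _ => false, fun _ => true}
    | _ => ∅

/-- The two-element Boolean algebra `(2, ∨, ∧, ¬)`. -/
def boolAlg : AlgStr Bool where
  ops n := match n with
    | 2 => {fun v => v 0 || v 1, fun v => v 0 && v 1}
    | 1 => {fun v => !v 0}
    | _ => ∅

/-- The ranked alphabet `{∧, 0, 1}`. -/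
inductive BLet : Type where
  | band : BLet
  | bzero : BLet
  | bone : BLet

/-- Arities in `{∧, 0, 1}`: `∧` is binary, `0` and `1` are nullary. -/
def BLet.ar : BLet → ℕ
  | .band => 2
  | .bzero => 0
  | .bone => 0

/-- Evaluating a tree over `{∧, 0, 1}` as a Boolean formula. -/
def evalB : RTree BLet BLet.ar → Bool
  | .node .band ts => evalB (ts (0 : Fin 2)) && evalB (ts (1 : Fin 2))
  | .node .bzero _ => false
  | .node .bone _ => true

/-- The ranked alphabet whose letters are the operations of an algebra. -/
def OpsAlphabet {α : Type} (A : AlgStr α) : Type :=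
  (n : ℕ) × {f : (Fin n → α) → α // f ∈ A.ops n}

/-- Bottom-up evaluation of a tree of operations of `A` in `A`. -/
def evalOps {α : Type} (A : AlgStr α) : RTree (OpsAlphabet A) (fun g => g.1) → α
  | .node g ts => g.2.1 (fun i => evalOps A (ts i))

/-! ## Wreath products and nesting -/

/-- The wreath product `A ∘ B`. -/
def wreath {α β : Type} (A : AlgStr α) (B : AlgStr β) : AlgStr (α × β) where
  ops n := { F | ∃ f ∈ B.ops n, ∃ am : β → ((Fin n → α) → α),
      (∀ b, am b ∈ A.ops n) ∧
      ∀ xs : Fin n → α × β,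
        F xs = (am (f fun i => (xs i).2) (fun i => (xs i).1), f fun i => (xs i).2) }

/-- Annotating each node of a tree with the value of `h` on the subtree rooted there. -/
def annotate {S : Type} {ar : S → ℕ} {β : Type} (h : RTree S ar → β) :
    RTree S ar → RTree (S × β) (fun p => ar p.1)
  | .node a ts => RTree.node (a, h (RTree.node a ts)) (fun i => annotate h (ts i))

/-- `t^{L₁,…,Lₙ}`: annotate each node with the bit vector of memberships of its
subtree in the languages `Ls`. -/
noncomputable def nestAnnotate {S : Type} {ar : S → ℕ} {n : ℕ}
    (Ls : Fin n → Set (RTree S ar)) :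
    RTree S ar → RTree (S × (Fin n → Bool)) (fun p => ar p.1) :=
  annotate (fun u j => @decide (u ∈ Ls j) (Classical.propDecidable _))

/-- A class of tree languages (one family per ranked alphabet). -/
def LangClass : Type 1 :=
  ∀ (S : Type) (ar : S → ℕ), Set (Set (RTree S ar))

/-- Closure of a class of tree languages under nesting. -/
def ClosedUnderNesting (𝓛 : LangClass) : Prop :=
  ∀ (S : Type) [Finite S] (ar : S → ℕ) (n : ℕ) (Ls : Fin n → Set (RTree S ar))
    (L : Set (RTree (S × (Fin n → Bool)) (fun p => ar p.1))),
    (∀ j, Ls j ∈ 𝓛 S ar) → L ∈ 𝓛 (S × (Fin n → Bool)) (fun p => ar p.1) →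
    { t | nestAnnotate Ls t ∈ L } ∈ 𝓛 S ar

/-- The least class of algebras containing `𝒜` and closed under wreath products. -/
inductive WClosure (𝒜 : ∀ α : Type, AlgStr α → Prop) : ∀ α : Type, AlgStr α → Prop where
  | base {α : Type} {A : AlgStr α} : 𝒜 α A → WClosure 𝒜 α A
  | wreath {α β : Type} {A : AlgStr α} {B : AlgStr β} :
      WClosure 𝒜 α A → WClosure 𝒜 β B → WClosure 𝒜 (α × β) (wreath A B)

/-- The tree languages (over a fixed alphabet) recognised by algebras from a class. -/
def LangOf (𝒞 : ∀ α : Type, AlgStr α → Prop) (S : Type) (ar : S → ℕ) :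
    Set (Set (RTree S ar)) :=
  { L | ∃ (α : Type) (A : AlgStr α), 𝒞 α A ∧ Recognises A L }
/-- Composition of contexts: the second one is plugged into the hole of the first. -/
def TCtx.comp {S : Type} {ar : S → ℕ} : TCtx S ar → TCtx S ar → TCtx S ar
  | .hole, q => q
  | .node a i c other, q => .node a i (c.comp q) other

theorem TCtx.plug_comp {S : Type} {ar : S → ℕ} (p q : TCtx S ar) (t : RTree S ar) :
    (p.comp q).plug t = p.plug (q.plug t) := by
  induction p with
  | hole => rfl
  | node a i c other ih => simp only [TCtx.comp, TCtx.plug, ih]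

theorem synRel.plug {S : Type} {ar : S → ℕ} {L : Set (RTree S ar)} {t t' : RTree S ar}
    (h : synRel L t t') (q : TCtx S ar) : synRel L (q.plug t) (q.plug t') := fun p => by
  simpa only [TCtx.plug_comp] using h (p.comp q)

theorem TCtx.plug_node_hole {S : Type} {ar : S → ℕ} (a : S) (i : Fin (ar a))
    (us : Fin (ar a) → RTree S ar) (t : RTree S ar) :
    (TCtx.node a i .hole fun j _ => us j).plug t = RTree.node a (Function.update us i t) := by
  simp only [TCtx.plug]
  congr 1
  funext j
  by_cases h : j = i
  · subst h; simp
  · simp [h]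

theorem synRel.node {S : Type} {ar : S → ℕ} {L : Set (RTree S ar)} (a : S)
    {us vs : Fin (ar a) → RTree S ar} (h : ∀ i, synRel L (us i) (vs i)) :
    synRel L (RTree.node a us) (RTree.node a vs) := by
  classical
  suffices H : ∀ s : Finset (Fin (ar a)),
      synRel L (RTree.node a us) (RTree.node a (s.piecewise vs us)) by
    simpa using H Finset.univ
  intro s
  induction s using Finset.induction_on with
  | empty => exact Finset.piecewise_empty vs us ▸ (synSetoid L).refl _
  | insert i s hi ih =>
    refine (synSetoid L).trans ih ?_
    have key := (h i).plug (.node a i .hole fun j _ => s.piecewise vs us j)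
    have hu : Function.update (s.piecewise vs us) i (us i) = s.piecewise vs us := by
      simp [hi]
    rwa [TCtx.plug_node_hole, TCtx.plug_node_hole, hu, ← Finset.piecewise_insert] at key

/-- Trees with the same value under a homomorphism have the same value in every context. -/
theorem IsHom.plug_congr {S : Type} {ar : S → ℕ} {α : Type} {A : AlgStr α}
    {h : RTree S ar → α} (hh : IsHom A h) {t t' : RTree S ar} (e : h t = h t')
    (p : TCtx S ar) : h (p.plug t) = h (p.plug t') := by
  induction p with
  | hole => exact e
  | node a i c other ih =>
    obtain ⟨f, -, hf⟩ := hh a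
    simp only [TCtx.plug, hf]
    congr 1
    funext j
    by_cases hj : j = i <;> simp [hj, ih]

theorem IsHom.synRel {S : Type} {ar : S → ℕ} {α : Type} {A : AlgStr α}
    {h : RTree S ar → α} (hh : IsHom A h) (F : Set α) {t t' : RTree S ar} (e : h t = h t') :
    synRel (h ⁻¹' F) t t' := fun p => by
  simp only [Set.mem_preimage, hh.plug_congr e p]

theorem isHom_synMap {S : Type} {ar : S → ℕ} (L : Set (RTree S ar)) :
    IsHom (synAlg L) (synMap L) := by
  intro a
  have key (us : Fin (ar a) → RTree S ar) :
      Quotient.mk (synSetoid L)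
          (RTree.node a fun i => (Quotient.mk (synSetoid L) (us i)).out) =
        Quotient.mk (synSetoid L) (RTree.node a us) :=
    Quotient.sound (synRel.node a fun i => Quotient.mk_out (s := synSetoid L) (us i))
  exact ⟨fun v => Quotient.mk (synSetoid L) (RTree.node a fun i => (v i).out),
    ⟨a, rfl, key⟩, fun us => (key us).symm⟩

theorem recognises_synAlg {S : Type} {ar : S → ℕ} (L : Set (RTree S ar)) :
    Recognises (synAlg L) L := by
  refine ⟨synMap L, isHom_synMap L, synMap L '' L, ?_⟩
  ext t
  refine ⟨fun ht => ⟨t, ht, rfl⟩, ?_⟩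
  rintro ⟨t', ht', e⟩
  exact (Quotient.exact e .hole).1 ht'

theorem divides_synAlg {S : Type} {ar : S → ℕ} {L : Set (RTree S ar)} {β : Type} {B : AlgStr β}
    (hB : Recognises B L) : Divides (synAlg L) B := by
  obtain ⟨h, hh, F, rfl⟩ := hB
  have hφ (c : Set.range h) (t : RTree S ar) (e : c.1 = h t) :
      synMap (h ⁻¹' F) c.2.choose = synMap (h ⁻¹' F) t :=
    Quotient.sound (hh.synRel F (c.2.choose_spec.trans e))
  refine ⟨Set.range h, fun c => synMap (h ⁻¹' F) c.2.choose, ?_, ?_⟩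
  · intro q
    induction q using Quotient.inductionOn with
    | h t => exact ⟨⟨h t, t, rfl⟩, hφ _ t rfl⟩
  · rintro n f ⟨a, rfl, hf⟩
    obtain ⟨g, hg, hgh⟩ := hh a
    have hx (xs : Fin (ar a) → Set.range h) :
        g (fun i => (xs i).1) = h (RTree.node a fun i => (xs i).2.choose) := by
      rw [hgh]
      congr 1
      funext i
      exact (xs i).2.choose_spec.symm
    exact ⟨g, hg, fun xs => ⟨_, (hx xs).symm⟩,
      fun xs => (hφ _ _ (hx xs)).trans (hf fun i => (xs i).2.choose).symm⟩

theorem Divides.finite {α β : Type} {A : AlgStr α} {B : AlgStr β} [Finite β]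
    (h : Divides A B) : Finite α := by
  obtain ⟨C, φ, hφ, -⟩ := h
  exact Finite.of_surjective φ hφ

theorem finite_ops_synAlg {S : Type} {ar : S → ℕ} [Finite S] (L : Set (RTree S ar)) :
    Finite ((n : ℕ) × {f : (Fin n → Quotient (synSetoid L)) → Quotient (synSetoid L) //
      f ∈ (synAlg L).ops n}) := by
  refine Finite.of_injective (fun g => g.2.2.choose) ?_
  rintro ⟨n, f, hf⟩ ⟨m, g, hg⟩ e
  obtain ⟨hn, hfn⟩ := hf.choose_spec
  obtain ⟨hm, hgm⟩ := hg.choose_spec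
  dsimp only at e
  obtain rfl : n = m := hn.symm.trans ((congrArg ar e).trans hm)
  obtain rfl : f = g := by
    funext v
    obtain ⟨us, rfl⟩ : ∃ us : Fin n → RTree S ar, v = fun i => Quotient.mk (synSetoid L) (us i) :=
      ⟨fun i => (v i).out, funext fun i => (Quotient.out_eq _).symm⟩
    rw [hfn, hgm]
    clear hfn hgm
    generalize hf.choose = a at *
    generalize hg.choose = b at *
    subst e
    rfl
  rfl

/-- **Myhill–Nerode theorem for trees.** For every regular tree language `L`
there is a finite algebra recognising `L` which divides every algebra recognising `L`;
namely, the quotient of the tree algebra by the syntactic congruence of `L` (the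
syntactic algebra) has this property. -/
theorem statement2 {S : Type} {ar : S → ℕ} [Finite S]
    (L : Set (RTree S ar)) (hL : TreeRegular L) :
    FiniteAlg (synAlg L) ∧ Recognises (synAlg L) L ∧
    ∀ (β : Type) (B : AlgStr β), Recognises B L → Divides (synAlg L) B := by
  obtain ⟨α, A, ⟨hα, -⟩, hA⟩ := hL
  exact ⟨⟨(divides_synAlg hA).finite, finite_ops_synAlg L⟩, recognises_synAlg L,
    fun _ _ => divides_synAlg⟩
end

section
/- Let L ⊆ Trees(Σ) be a regular tree language and let h : Trees(Σ) → A be the quotient homomorphism onto the syntactic algebra of L. Then for every subset F of the carrier of A, the language h⁻¹(F) is a finite Boolean combination of derivatives of L. -/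
set_option autoImplicit false

theorem IsHom.map_plug_eq {S : Type} {ar : S → ℕ} {α : Type} {A : AlgStr α}
    {h : RTree S ar → α} (hh : IsHom A h) (p : TCtx S ar) {t t' : RTree S ar}
    (e : h t = h t') : h (p.plug t) = h (p.plug t') := by
  induction p with
  | hole => exact e
  | node a i c other ih =>
    obtain ⟨f, -, hf⟩ := hh a
    simp only [TCtx.plug, hf]
    congr 1
    funext j
    by_cases hj : j = i
    · simpa [hj] using ih
    · simp [hj]

/-- A regular tree language has finitely many derivatives. -/
theorem TreeRegular.finite_derivatives {S : Type} {ar : S → ℕ} {L : Set (RTree S ar)}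
    (hL : TreeRegular L) : { D | IsDerivative L D }.Finite := by
  obtain ⟨α, A, ⟨hα, -⟩, h, hh, F, rfl⟩ := hL
  refine (Set.finite_range (fun s : Set α => h ⁻¹' s)).subset ?_
  rintro D ⟨p, rfl⟩
  refine ⟨h '' {t | p.plug t ∈ h ⁻¹' F}, ?_⟩
  ext t
  constructor
  · rintro ⟨t', ht', e⟩
    have := hh.map_plug_eq p e
    simp only [Set.mem_ofPred_eq, Set.mem_preimage] at ht' ⊢
    rwa [← this]
  · exact fun ht => ⟨t, ht, rfl⟩

namespace BoolComb

variable {X : Type} {G : Set (Set X)}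

theorem univ (hG : G.Nonempty) : BoolComb G Set.univ := by
  obtain ⟨s, hs⟩ := hG
  rw [← Set.union_compl_self s]
  exact .union (.base hs) (.compl (.base hs))

theorem empty (hG : G.Nonempty) : BoolComb G ∅ := by
  rw [← Set.compl_univ]
  exact .compl (univ hG)

theorem sUnion (hG : G.Nonempty) {C : Set (Set X)} (hC : C.Finite)
    (h : ∀ s ∈ C, BoolComb G s) : BoolComb G (⋃₀ C) := by
  induction C, hC using Set.Finite.induction_on with
  | empty => simpa using empty hG
  | insert _ _ ih =>
    rw [Set.sUnion_insert]
    exact .union (h _ (Set.mem_insert _ _)) (ih fun s hs => h s (Set.mem_insert_of_mem _ hs))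

theorem sInter (hG : G.Nonempty) {C : Set (Set X)} (hC : C.Finite)
    (h : ∀ s ∈ C, BoolComb G s) : BoolComb G (⋂₀ C) := by
  rw [Set.sInter_eq_compl_sUnion_compl]
  refine .compl (sUnion hG (hC.image _) ?_)
  rintro _ ⟨s, hs, rfl⟩
  exact .compl (h s hs)

/-- A set that is a union of classes of the equivalence "belong to the same members of `G`"
is a Boolean combination of members of `G`, when `G` is finite and nonempty. -/
theorem of_saturated (hG : G.Nonempty) (hfin : G.Finite) {s : Set X}
    (hs : ∀ x y, (∀ g ∈ G, x ∈ g ↔ y ∈ g) → x ∈ s → y ∈ s) : BoolComb G s := by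
  let atom (H : Set (Set X)) : Set X := ⋂₀ H ∩ ⋂₀ ((·ᶜ) '' (G \ H))
  have key : s = ⋃₀ ((fun x => atom {g ∈ G | x ∈ g}) '' s) := by
    ext y
    constructor
    · intro hy
      refine ⟨_, ⟨y, hy, rfl⟩, fun g hg => hg.2, ?_⟩
      rintro _ ⟨g, ⟨hg, hgy⟩, rfl⟩
      exact fun h => hgy ⟨hg, h⟩
    · rintro ⟨_, ⟨x, hx, rfl⟩, hpos, hneg⟩
      refine hs x y (fun g hg => ⟨fun h => hpos g ⟨hg, h⟩, fun h => ?_⟩) hx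
      by_contra hxg
      exact hneg _ ⟨g, ⟨hg, fun h' => hxg h'.2⟩, rfl⟩ h
  rw [key]
  refine sUnion hG ((hfin.finite_subsets.image atom).subset ?_) ?_
  · rintro _ ⟨x, -, rfl⟩
    exact ⟨_, Set.sep_subset _ _, rfl⟩
  · rintro _ ⟨x, -, rfl⟩
    refine .inter (sInter hG (hfin.subset (Set.sep_subset _ _)) fun g hg => .base hg.1)
      (sInter hG (hfin.sdiff.image _) ?_)
    rintro _ ⟨g, hg, rfl⟩
    exact .compl (.base hg.1)

end BoolComb

/-- For a regular tree language `L` and the syntactic (quotient)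
homomorphism `h` onto the syntactic algebra of `L`, the preimage `h⁻¹(F)` of every
subset `F` of the carrier is a finite Boolean combination of derivatives of `L`. -/
theorem statement3 {S : Type} {ar : S → ℕ} [Finite S]
    (L : Set (RTree S ar)) (hL : TreeRegular L) (F : Set (Quotient (synSetoid L))) :
    BoolComb { D | IsDerivative L D } (synMap L ⁻¹' F) := by
  have hG : { D | IsDerivative L D }.Nonempty := ⟨_, TCtx.hole, rfl⟩
  refine BoolComb.of_saturated hG hL.finite_derivatives fun t t' h ht => ?_
  have e : synMap L t = synMap L t' :=
    Quotient.sound (s := synSetoid L) fun p => h {u | p.plug u ∈ L} ⟨p, rfl⟩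
  rwa [Set.mem_preimage, ← e]
end

section
/- Let f : Trees(Σ) → Trees(Γ) be a deterministic top-down tree transducer whose set of states is {1,...,n}, and let g : Trees(Γ) → A be a homomorphism into a finite algebra A. Then there is a homomorphism h : Trees(Σ) → A^[n] into the n-th matrix power of A satisfying h(t) = (g(f₁(t)),...,g(fₙ(t))) for all t ∈ Trees(Σ), where f_i denotes the transducer f with its initial state changed to i. In particular, every tree language recognised by the composition g ∘ f is recognised by a homomorphism into some matrix power of A. -/
set_option autoImplicit false

/-- The value under a homomorphism `g` of a term whose variables have been replaced by trees
is a polynomial in the values under `g` of these trees. -/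
theorem IsHom.exists_polyTerm_eval_subst {G : Type} {arG : G → ℕ} {α : Type} {A : AlgStr α}
    {g : RTree G arG → α} (hg : IsHom A g) {X : Type} {m : ℕ} (e : X → Fin m)
    (t : TTerm G arG X) :
    ∃ p : PolyTerm A m, ∀ (σ : X → RTree G arG) (xs : Fin m → α),
      (∀ x, xs (e x) = g (σ x)) → g (t.subst σ) = p.eval xs := by
  induction t with
  | var x => exact ⟨.var (e x), fun σ xs h => (h x).symm⟩
  | node b ts ih =>
    choose p hp using ih
    obtain ⟨f, hf, hfg⟩ := hg b
    refine ⟨.app _ f hf p, fun σ xs h => ?_⟩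
    rw [TTerm.subst, hfg, PolyTerm.eval]
    exact congrArg f (funext fun i => hp i σ xs h)

theorem concatTuples_finProdFinEquiv {α : Type} {n k : ℕ} (as : Fin k → Fin n → α)
    (x : Fin n × Fin k) : concatTuples n k as (finProdFinEquiv x) = as x.2 x.1 := by
  simp [concatTuples]

/-- Composing a dtop with a homomorphism into `A`, simultaneously for all initial states, gives
a homomorphism into a matrix power of `A`. -/
theorem IsHom.matrixPower_run {S : Type} {ar : S → ℕ} {G : Type} {arG : G → ℕ} {α : Type}
    {A : AlgStr α} {n : ℕ} (d : DTOP S ar G arG (Fin n)) {g : RTree G arG → α}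
    (hg : IsHom A g) : IsHom (matrixPower A n) (fun t i => g (d.run t i)) := by
  intro a
  choose p hp using fun q => hg.exists_polyTerm_eval_subst finProdFinEquiv (d.δ a q)
  refine ⟨fun as i => (p i).eval (concatTuples n (ar a) as),
    ⟨fun i => (p i).eval, fun i => ⟨p i, fun _ => rfl⟩, fun _ => rfl⟩, fun ts => ?_⟩
  funext q
  simp only [DTOP.run]
  exact hp q _ _ fun x => concatTuples_finProdFinEquiv _ x

/-- Given a dtop with states `{1,…,n}` and a homomorphism `g` from
output trees into a finite algebra `A`, there is a homomorphism `h` into the `n`-th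
matrix power `A^[n]` with `h t = (g(f₁ t),…,g(fₙ t))`, where `fᵢ` is the transducer
started in state `i`. In particular, every language recognised by `g ∘ f` is
recognised by a homomorphism into some matrix power of `A`. -/
theorem statement6 {S : Type} {ar : S → ℕ} [Finite S] {G : Type} {arG : G → ℕ} [Finite G]
    {α : Type} (A : AlgStr α) (hfin : FiniteAlg A) (n : ℕ)
    (d : DTOP S ar G arG (Fin n)) (g : RTree G arG → α) (hg : IsHom A g) :
    ∃ h : RTree S ar → (Fin n → α),
      IsHom (matrixPower A n) h ∧
      (∀ t, h t = fun i => g (d.run t i)) ∧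
      ∀ F : Set α,
        ∃ m : ℕ, Recognises (matrixPower A m) ((fun t => g (d.run t d.init)) ⁻¹' F) := by
  exact ⟨fun t i => g (d.run t i), hg.matrixPower_run d, fun _ => rfl, fun F =>
    ⟨n, fun t i => g (d.run t i), hg.matrixPower_run d, {v | v d.init ∈ F}, rfl⟩⟩
end

section
/- For every finite algebra A and every ranked alphabet Σ, the class of tree languages { L ⊆ Trees(Σ) : L is recognised by a homomorphism into some matrix power A^[n] of A } is closed under Boolean operations: union, intersection, and complementation. -/
set_option autoImplicit false

/-! ## Products of homomorphisms into matrix powers -/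

/-- Renaming the variables of a polynomial term. -/
def PolyTerm.rename {α : Type} {A : AlgStr α} {m m' : ℕ} (σ : Fin m → Fin m') :
    PolyTerm A m → PolyTerm A m'
  | .var i => .var (σ i)
  | .const c => .const c
  | .app n f hf args => .app n f hf (fun j => (args j).rename σ)

theorem PolyTerm.eval_rename {α : Type} {A : AlgStr α} {m m' : ℕ} (σ : Fin m → Fin m')
    (p : PolyTerm A m) (xs : Fin m' → α) :
    (p.rename σ).eval xs = p.eval (fun i => xs (σ i)) := by
  induction p with
  | var i => rfl
  | const c => rfl
  | app n f hf args ih => simp only [PolyTerm.rename, PolyTerm.eval, ih]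

/-- Polynomial operations are closed under renaming of variables. -/
theorem Pol.comp_rename {α : Type} {A : AlgStr α} {m m' : ℕ} {g : (Fin m → α) → α}
    (hg : g ∈ Pol A m) (σ : Fin m → Fin m') : (fun xs => g (fun i => xs (σ i))) ∈ Pol A m' := by
  obtain ⟨p, hp⟩ := hg
  exact ⟨p.rename σ, fun xs => (hp _).trans (p.eval_rename σ xs).symm⟩

/-- Applying an injection of coordinates `Fin n → Fin n'` inside each block of a
concatenation of `k` tuples. -/
def blockMap {n n' : ℕ} (k : ℕ) (ι : Fin n → Fin n') (j : Fin (n * k)) : Fin (n' * k) :=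
  finProdFinEquiv (ι (finProdFinEquiv.symm j).1, (finProdFinEquiv.symm j).2)

theorem concatTuples_blockMap {α : Type} {n n' k : ℕ} (ι : Fin n → Fin n')
    (as : Fin k → Fin n' → α) :
    (fun j => concatTuples n' k as (blockMap k ι j)) =
      concatTuples n k (fun l i => as l (ι i)) := by
  funext j
  simp only [concatTuples, blockMap, Equiv.symm_apply_apply]

/-- The pairing of two homomorphisms into matrix powers is a homomorphism into a matrix power. -/
theorem IsHom.append {S : Type} {ar : S → ℕ} {α : Type} {A : AlgStr α} {n m : ℕ}
    {h : RTree S ar → Fin n → α} {g : RTree S ar → Fin m → α}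
    (hh : IsHom (matrixPower A n) h) (hg : IsHom (matrixPower A m) g) :
    IsHom (matrixPower A (n + m)) (fun t => Fin.append (h t) (g t)) := by
  intro a
  obtain ⟨F, ⟨fs, hfs, hF⟩, hFh⟩ := hh a
  obtain ⟨G, ⟨gs, hgs, hG⟩, hGg⟩ := hg a
  let us : Fin (n + m) → ((Fin ((n + m) * ar a) → α) → α) :=
    Fin.append (fun i xs => fs i (fun j => xs (blockMap (ar a) (Fin.castAdd m) j)))
      (fun i xs => gs i (fun j => xs (blockMap (ar a) (Fin.natAdd n) j)))
  refine ⟨fun as i => us i (concatTuples (n + m) (ar a) as), ⟨us, fun i => ?_, fun _ => rfl⟩,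
    fun ts => ?_⟩
  · refine Fin.addCases (fun i => ?_) (fun i => ?_) i
    · simpa only [us, Fin.append_left] using Pol.comp_rename (hfs i) _
    · simpa only [us, Fin.append_right] using Pol.comp_rename (hgs i) _
  · funext i
    refine Fin.addCases (fun i => ?_) (fun i => ?_) i
    · simp only [us, Fin.append_left, concatTuples_blockMap, hFh, hF]
    · simp only [us, Fin.append_right, concatTuples_blockMap, hGg, hG]

/-- For every finite algebra `A` and ranked alphabet `Σ`, the class of
tree languages recognised by homomorphisms into matrix powers of `A` is closed under
union, intersection, and complementation. -/
theorem statement8 {S : Type} {ar : S → ℕ} [Finite S] {α : Type}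
    (A : AlgStr α) (hfin : FiniteAlg A) :
    (∀ L K : Set (RTree S ar),
      (∃ n : ℕ, Recognises (matrixPower A n) L) →
      (∃ n : ℕ, Recognises (matrixPower A n) K) →
      (∃ n : ℕ, Recognises (matrixPower A n) (L ∪ K)) ∧
      (∃ n : ℕ, Recognises (matrixPower A n) (L ∩ K))) ∧
    (∀ L : Set (RTree S ar),
      (∃ n : ℕ, Recognises (matrixPower A n) L) →
      ∃ n : ℕ, Recognises (matrixPower A n) Lᶜ) := by
  refine ⟨?_, ?_⟩
  · rintro L K ⟨n, h, hh, F, rfl⟩ ⟨m, g, hg, G, rfl⟩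
    refine ⟨⟨n + m, _, hh.append hg,
        {v | (fun i => v (Fin.castAdd m i)) ∈ F ∨ (fun i => v (Fin.natAdd n i)) ∈ G}, ?_⟩,
      ⟨n + m, _, hh.append hg,
        {v | (fun i => v (Fin.castAdd m i)) ∈ F ∧ (fun i => v (Fin.natAdd n i)) ∈ G}, ?_⟩⟩ <;>
    · ext t
      simp
  · rintro L ⟨n, h, hh, F, rfl⟩
    exact ⟨n, h, hh, Fᶜ, rfl⟩
end

section
/- A tree language L ⊆ Trees(Σ) is of the form (eval ∘ f)⁻¹(1), where f : Trees(Σ) → Trees({∧,0,1}) is a deterministic top-down tree transducer and eval : Trees({∧,0,1}) → {0,1} is the homomorphism evaluating a tree as a Boolean formula (∧ binary, 0 and 1 nullary), if and only if L is a universal path language. -/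
set_option autoImplicit false

/-- A term over `{∧, 0, 1}` evaluates to `1` iff a condition independent of the substitution
holds and all variables from some set evaluate to `1`. -/
theorem TTerm.exists_evalB_subst_iff {X : Type} (t : TTerm BLet BLet.ar X) :
    ∃ (c : Prop) (V : Set X), ∀ σ : X → RTree BLet BLet.ar,
      evalB (t.subst σ) = true ↔ c ∧ ∀ x ∈ V, evalB (σ x) = true := by
  induction t with
  | var x => exact ⟨True, {x}, fun σ => by simp [TTerm.subst]⟩
  | node b ts ih =>
    cases b with
    | band =>
      obtain ⟨c₀, V₀, h₀⟩ := ih (0 : Fin 2)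
      obtain ⟨c₁, V₁, h₁⟩ := ih (1 : Fin 2)
      refine ⟨c₀ ∧ c₁, V₀ ∪ V₁, fun σ => ?_⟩
      simp only [TTerm.subst, evalB, Bool.and_eq_true, h₀, h₁, Set.mem_union, or_imp,
        forall_and]
      tauto
    | bzero => exact ⟨False, ∅, fun σ => by simp [TTerm.subst, evalB]⟩
    | bone => exact ⟨True, ∅, fun σ => by simp [TTerm.subst, evalB]⟩

/-- The conjunction of a list of terms over `{∧, 0, 1}`. -/
def TTerm.conj {X : Type} : List (TTerm BLet BLet.ar X) → TTerm BLet BLet.ar X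
  | [] => .node .bone Fin.elim0
  | t :: l => .node .band (fun i : Fin 2 => if i = 0 then t else TTerm.conj l)

theorem TTerm.evalB_subst_conj {X : Type} (σ : X → RTree BLet BLet.ar)
    (l : List (TTerm BLet BLet.ar X)) :
    evalB ((TTerm.conj l).subst σ) = true ↔ ∀ t ∈ l, evalB (t.subst σ) = true := by
  induction l with
  | nil => simp [TTerm.conj, TTerm.subst, evalB]
  | cons t l ih => simp [TTerm.conj, TTerm.subst, evalB, ih]

/-- The path letter of a leaf. -/
def PathLetter.leaf {S : Type} {ar : S → ℕ} (a : S) (h : ar a = 0) : PathLetter S ar :=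
  Sum.inl ⟨a, h⟩

/-- The path letter of a node at which the path proceeds to the `i`-th child. -/
def PathLetter.child {S : Type} {ar : S → ℕ} (a : S) (i : Fin (ar a)) : PathLetter S ar :=
  Sum.inr ⟨a, i⟩

theorem exists_isPathWord {S : Type} {ar : S → ℕ} (t : RTree S ar) : ∃ w, IsPathWord t w := by
  induction t with
  | node a ts ih =>
    by_cases h : ar a = 0
    · exact ⟨_, .leaf a h ts⟩
    · obtain ⟨w, hw⟩ := ih ⟨0, Nat.pos_of_ne_zero h⟩
      exact ⟨_, .step a ts _ w hw⟩

theorem forall_isPathWord_node {S : Type} {ar : S → ℕ} (a : S)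
    (ts : Fin (ar a) → RTree S ar) (P : List (PathLetter S ar) → Prop) :
    (∀ w, IsPathWord (RTree.node a ts) w → P w) ↔
      (∀ h : ar a = 0, P [.leaf a h]) ∧
        ∀ i w, IsPathWord (ts i) w → P (.child a i :: w) := by
  refine ⟨fun H => ⟨fun h => H _ (.leaf a h ts), fun i w hw => H _ (.step a ts i w hw)⟩, ?_⟩
  rintro ⟨h₀, h₁⟩ w hw
  cases hw with
  | leaf _ h _ => exact h₀ h
  | step _ _ i w hw => exact h₁ i w hw

/-- The automaton tracking, along a path, the set of states whose acceptance of the current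
subtree is required. Acceptance from `q` of a tree with root `a` requires `c a q`, and acceptance
from `p` of the `i`-th child for all `(p, i) ∈ V a q`; `none` is the rejecting sink. -/
noncomputable def obligationDFA {S : Type} {ar : S → ℕ} {Q : Type} (q₀ : Q) (c : S → Q → Prop)
    (V : (a : S) → Q → Set (Q × Fin (ar a))) : DFA (PathLetter S ar) (Option (Set Q)) :=
  open Classical in
  { step := fun s x => s.bind fun P => match x with
      | .inl a => if ∀ q ∈ P, c a.1 q then some ∅ else none
      | .inr ⟨a, i⟩ =>
        if ∀ q ∈ P, c a q then some {p | ∃ q ∈ P, (p, i) ∈ V a q} else none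
    start := some {q₀}
    accept := {none}ᶜ }

section obligationDFA

variable {S : Type} {ar : S → ℕ} {Q : Type} {q₀ : Q} {c : S → Q → Prop}
  {V : (a : S) → Q → Set (Q × Fin (ar a))}

theorem obligationDFA_evalFrom_none (w : List (PathLetter S ar)) :
    (obligationDFA q₀ c V).evalFrom none w = none := by
  induction w with
  | nil => rfl
  | cons x w ih => rw [DFA.evalFrom_cons]; exact ih

theorem forall_acc_iff_forall_isPathWord {acc : RTree S ar → Q → Prop}
    (hacc : ∀ a ts q, acc (.node a ts) q ↔ c a q ∧ ∀ x ∈ V a q, acc (ts x.2) x.1)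
    (t : RTree S ar) (P : Set Q) :
    (∀ q ∈ P, acc t q) ↔
      ∀ w, IsPathWord t w → (obligationDFA q₀ c V).evalFrom (some P) w ≠ none := by
  induction t generalizing P with
  | node a ts ih =>
    rw [forall_isPathWord_node]
    by_cases hc : ∀ q ∈ P, c a q
    · have hr (i : Fin (ar a)) : (obligationDFA q₀ c V).step (some P) (.child a i) =
          some {p | ∃ q ∈ P, (p, i) ∈ V a q} := if_pos hc
      have hl (h : ar a = 0) : (obligationDFA q₀ c V).step (some P) (.leaf a h) = some ∅ :=
        if_pos hc
      simp only [DFA.evalFrom_cons, DFA.evalFrom_nil, hr, hl, ← ih, hacc]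
      constructor
      · rintro H
        refine ⟨fun _ => Option.some_ne_none _, ?_⟩
        rintro i p ⟨q, hq, hp⟩
        exact (H q hq).2 _ hp
      · rintro ⟨-, H⟩ q hq
        exact ⟨hc q hq, fun x hx => H x.2 x.1 ⟨q, hq, hx⟩⟩
    · have hr (i : Fin (ar a)) : (obligationDFA q₀ c V).step (some P) (.child a i) = none :=
        if_neg hc
      have hl (h : ar a = 0) : (obligationDFA q₀ c V).step (some P) (.leaf a h) = none :=
        if_neg hc
      refine iff_of_false (fun H => hc fun q hq => ((hacc a ts q).1 (H q hq)).1) ?_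
      rintro ⟨H₀, H₁⟩
      by_cases h : ar a = 0
      · exact H₀ h (hl h)
      · obtain ⟨w, hw⟩ := exists_isPathWord (ts ⟨0, Nat.pos_of_ne_zero h⟩)
        refine H₁ _ w hw ?_
        rw [DFA.evalFrom_cons, hr, obligationDFA_evalFrom_none]

end obligationDFA

/-- The transducer running a word automaton along all paths, and outputting the conjunction of
the results. -/
noncomputable def pathDTOP {S : Type} {ar : S → ℕ} {Q : Type} (M : DFA (PathLetter S ar) Q) :
    DTOP S ar BLet BLet.ar Q :=
  open Classical in
  { init := M.start
    δ := fun a q =>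
      if h : ar a = 0 then
        if M.step q (.leaf a h) ∈ M.accept then .node .bone Fin.elim0
        else .node .bzero Fin.elim0
      else .conj ((List.finRange (ar a)).map fun i => .var (M.step q (.child a i), i)) }

theorem evalB_run_pathDTOP {S : Type} {ar : S → ℕ} {Q : Type} (M : DFA (PathLetter S ar) Q)
    (t : RTree S ar) (q : Q) :
    evalB ((pathDTOP M).run t q) = true ↔
      ∀ w, IsPathWord t w → M.evalFrom q w ∈ M.accept := by
  induction t generalizing q with
  | node a ts ih =>
    rw [forall_isPathWord_node]
    simp only [DFA.evalFrom_cons, DFA.evalFrom_nil, ← ih]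
    by_cases h : ar a = 0
    · have hi (i : Fin (ar a)) : False := (Fin.cast h i).elim0
      by_cases hM : M.step q (.leaf a h) ∈ M.accept
      · simp only [DTOP.run, pathDTOP, dif_pos h, if_pos hM, TTerm.subst, evalB, true_iff]
        exact ⟨fun _ => hM, fun i => (hi i).elim⟩
      · simp only [DTOP.run, pathDTOP, dif_pos h, if_neg hM, TTerm.subst, evalB]
        exact iff_of_false Bool.false_ne_true fun H => hM (H.1 h)
    · rw [DTOP.run]
      simp only [pathDTOP, dif_neg h, TTerm.evalB_subst_conj, List.forall_mem_map,
        TTerm.subst, List.mem_finRange, true_imp_iff]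
      exact ⟨fun H => ⟨fun h' => (h h').elim, H⟩, fun H => H.2⟩

/-- A tree language is of the form `(eval ∘ f)⁻¹(1)` for a dtop `f`
into trees over `{∧,0,1}` (with `eval` the Boolean evaluation homomorphism) if and
only if it is a universal path language. -/
theorem statement9 {S : Type} {ar : S → ℕ} [Finite S] (L : Set (RTree S ar)) :
    (∃ (Q : Type) (_ : Finite Q) (d : DTOP S ar BLet BLet.ar Q),
        L = (fun t => evalB (d.run t d.init)) ⁻¹' {true}) ↔
      IsUniversalPathLang L := by
  constructor
  · rintro ⟨Q, _, d, rfl⟩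
    choose c V hcV using fun a q => (d.δ a q).exists_evalB_subst_iff
    refine ⟨_, ⟨_, inferInstance, obligationDFA d.init c V, fun w => Iff.rfl⟩, ?_⟩
    ext t
    have h := forall_acc_iff_forall_isPathWord (q₀ := d.init)
      (acc := fun t q => evalB (d.run t q) = true)
      (fun a ts q => hcV a q fun p => d.run (ts p.2) p.1) t {d.init}
    simp only [Set.mem_singleton_iff, forall_eq] at h
    exact h
  · rintro ⟨W, ⟨Q, hQ, M, hM⟩, rfl⟩
    refine ⟨Q, hQ, pathDTOP M, ?_⟩
    ext t
    exact (forall₂_congr fun w _ => hM w).trans (evalB_run_pathDTOP M t M.start).symm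
end

section
/- A tree language L ⊆ Trees(Σ) is recognised by a homomorphism into some matrix power (2,∧)^[n] of the two-element semi-lattice (2,∧) if and only if L is a path language, i.e. a finite Boolean combination of universal path languages. -/
set_option autoImplicit false

namespace BoolComb

variable {X : Type} {G : Set (Set X)}

theorem empty_of {s : Set X} (hs : BoolComb G s) : BoolComb G ∅ := by
  simpa using hs.inter hs.compl

theorem biUnion {κ : Type} {I : Set κ} (hI : I.Finite) {f : κ → Set X}
    (h0 : BoolComb G ∅) (hf : ∀ k, BoolComb G (f k)) : BoolComb G (⋃ k ∈ I, f k) := by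
  induction I, hI using Set.Finite.induction_on with
  | empty => simpa using h0
  | insert _ _ ih =>
    rw [Set.biUnion_insert]
    exact (hf _).union ih

theorem iInter {κ : Type} [Finite κ] {f : κ → Set X}
    (h0 : BoolComb G ∅) (hf : ∀ k, BoolComb G (f k)) : BoolComb G (⋂ k, f k) := by
  have h := (biUnion (Set.finite_univ (α := κ)) h0 fun k => (hf k).compl).compl
  simpa using h

/-- A set determined by the values of finitely many predicates is a Boolean combination
of these predicates. -/
theorem preimage_of_finite {ι : Type} [Finite ι] (h : X → ι → Prop) (F : Set (ι → Prop))
    (h0 : BoolComb G ∅) (hh : ∀ i, BoolComb G {x | h x i}) : BoolComb G (h ⁻¹' F) := by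
  have hF : h ⁻¹' F = ⋃ v ∈ F, ⋂ i, {x | h x i ↔ v i} := by
    ext x
    simp only [Set.mem_preimage, Set.mem_iUnion, Set.mem_iInter, Set.mem_ofPred_eq, exists_prop]
    constructor
    · exact fun hx => ⟨h x, hx, fun _ => Iff.rfl⟩
    · rintro ⟨v, hv, hx⟩
      rwa [show h x = v from funext fun i => propext (hx i)]
  rw [hF]
  refine biUnion (Set.toFinite F) h0 fun v => iInter h0 fun i => ?_
  by_cases hv : v i
  · simpa [hv] using hh i
  · simpa [hv, Set.compl_ofPred] using (hh i).compl

end BoolComb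

/-! ### Polynomial operations of the semi-lattice -/

/-- A Boolean operation is conjunctive if it is the conjunction of a constant and a set of
its variables. -/
def IsConjunctive {m : ℕ} (g : (Fin m → Bool) → Bool) : Prop :=
  ∃ (c : Prop) (T : Set (Fin m)), ∀ xs, g xs = true ↔ c ∧ ∀ k ∈ T, xs k = true

theorem isConjunctive_eval {m : ℕ} (p : PolyTerm semilatticeAlg m) : IsConjunctive p.eval := by
  induction p with
  | var i => exact ⟨True, {i}, fun xs => by simp [PolyTerm.eval]⟩
  | const c => exact ⟨c = true, ∅, fun xs => by simp [PolyTerm.eval]⟩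
  | app n f hf args ih =>
    match n, f, hf, args, ih with
    | 2, f, hf, args, ih =>
      obtain rfl : f = fun v => v 0 && v 1 := hf
      obtain ⟨c, T, h⟩ := ih 0
      obtain ⟨d, U, h'⟩ := ih 1
      refine ⟨c ∧ d, T ∪ U, fun xs => ?_⟩
      simp only [PolyTerm.eval, Bool.and_eq_true, h, h', Set.mem_union, or_imp, forall_and]
      tauto

theorem exists_polyTerm_conj {m : ℕ} {T : Set (Fin m)} (hT : T.Finite) :
    ∃ p : PolyTerm semilatticeAlg m, ∀ xs, p.eval xs = true ↔ ∀ k ∈ T, xs k = true := by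
  induction T, hT using Set.Finite.induction_on with
  | empty => exact ⟨.const true, fun xs => by simp [PolyTerm.eval]⟩
  | @insert k T _ _ ih =>
    obtain ⟨p, hp⟩ := ih
    refine ⟨.app 2 (fun v => v 0 && v 1) rfl ![.var k, p], fun xs => ?_⟩
    simp [PolyTerm.eval, hp]

theorem mem_Pol_semilatticeAlg {m : ℕ} (g : (Fin m → Bool) → Bool) :
    g ∈ Pol semilatticeAlg m ↔ IsConjunctive g := by
  constructor
  · rintro ⟨p, hp⟩
    rw [show g = p.eval from funext hp]
    exact isConjunctive_eval p
  · rintro ⟨c, T, h⟩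
    by_cases hc : c
    · obtain ⟨p, hp⟩ := exists_polyTerm_conj (Set.toFinite T)
      exact ⟨p, fun xs => by rw [Bool.eq_iff_iff, h, hp]; simp [hc]⟩
    · exact ⟨.const false, fun xs => by rw [Bool.eq_iff_iff, h]; simp [hc, PolyTerm.eval]⟩

/-! ### Conjunctive families of tree predicates -/

section Trees

variable {S : Type} {ar : S → ℕ} {ι κ : Type}

/-- A family of tree predicates is conjunctive if its value at a tree is, in each coordinate,
a conjunction of a constant and of values at the immediate subtrees. -/
def IsConjFamily (h : RTree S ar → ι → Prop) : Prop :=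
  ∀ a i, ∃ (c : Prop) (T : Set (Fin (ar a) × ι)), ∀ ts,
    h (RTree.node a ts) i ↔ c ∧ ∀ p ∈ T, h (ts p.1) p.2

/-- A tree language is determined by a finite conjunctive family of tree predicates. -/
def ConjRecognisable (L : Set (RTree S ar)) : Prop :=
  ∃ (ι : Type) (_ : Finite ι) (h : RTree S ar → ι → Prop),
    IsConjFamily h ∧ ∃ F : Set (ι → Prop), L = h ⁻¹' F

theorem IsConjFamily.comp_equiv {h : RTree S ar → ι → Prop} (hh : IsConjFamily h) (e : κ ≃ ι) :
    IsConjFamily fun t k => h t (e k) := by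
  intro a k
  obtain ⟨c, T, hT⟩ := hh a (e k)
  refine ⟨c, {p | (p.1, e p.2) ∈ T}, fun ts => ?_⟩
  refine (hT ts).trans ?_
  refine and_congr_right fun _ => ⟨fun H p hp => H _ hp, fun H p hp => ?_⟩
  simpa using H (p.1, e.symm p.2) (by simpa using hp)

theorem IsConjFamily.sum {h : RTree S ar → ι → Prop} {g : RTree S ar → κ → Prop}
    (hh : IsConjFamily h) (hg : IsConjFamily g) :
    IsConjFamily fun t => Sum.elim (h t) (g t) := by
  rintro a (i | k)
  · obtain ⟨c, T, hT⟩ := hh a i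
    refine ⟨c, (fun p => (p.1, Sum.inl p.2)) '' T, fun ts => ?_⟩
    rw [Set.forall_mem_image]
    exact hT ts
  · obtain ⟨c, T, hT⟩ := hg a k
    refine ⟨c, (fun p => (p.1, Sum.inr p.2)) '' T, fun ts => ?_⟩
    rw [Set.forall_mem_image]
    exact hT ts

theorem isHom_matrixPower_iff {n : ℕ} (h : RTree S ar → Fin n → Bool) :
    IsHom (matrixPower semilatticeAlg n) h ↔ IsConjFamily fun t i => h t i = true := by
  constructor
  · intro hh a i
    obtain ⟨f, ⟨fs, hfs, hf⟩, hts⟩ := hh a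
    obtain ⟨c, T, hT⟩ := (mem_Pol_semilatticeAlg _).1 (hfs i)
    refine ⟨c, {p | finProdFinEquiv (p.2, p.1) ∈ T}, fun ts => ?_⟩
    simp only [hts, hf, hT, concatTuples]
    refine and_congr_right fun _ => ⟨fun H p hp => ?_, fun H k hk => ?_⟩
    · simpa using H _ hp
    · exact H ((finProdFinEquiv.symm k).2, (finProdFinEquiv.symm k).1)
        (by rwa [Set.mem_ofPred_eq, Prod.mk.eta, Equiv.apply_symm_apply])
  · intro hh a
    choose c T hT using hh a
    classical
    let fs : Fin n → (Fin (n * ar a) → Bool) → Bool := fun i xs =>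
      decide (c i ∧ ∀ p ∈ T i, xs (finProdFinEquiv (p.2, p.1)) = true)
    refine ⟨fun as i => fs i (concatTuples n (ar a) as), ⟨fs, fun i => ?_, fun _ => rfl⟩,
      fun ts => funext fun i => ?_⟩
    · refine (mem_Pol_semilatticeAlg _).2
        ⟨c i, (fun p => finProdFinEquiv (p.2, p.1)) '' T i, fun xs => ?_⟩
      simp only [fs, decide_eq_true_eq, Set.forall_mem_image]
    · rw [Bool.eq_iff_iff]
      refine (hT i ts).trans ?_
      simp only [fs, concatTuples, decide_eq_true_eq, Equiv.symm_apply_apply]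

theorem exists_recognises_matrixPower_iff (L : Set (RTree S ar)) :
    (∃ n : ℕ, Recognises (matrixPower semilatticeAlg n) L) ↔ ConjRecognisable L := by
  constructor
  · rintro ⟨n, h, hh, F, rfl⟩
    refine ⟨Fin n, inferInstance, _, (isHom_matrixPower_iff h).1 hh,
      (fun v i => v i = true) '' F, ?_⟩
    ext t
    simp only [Set.mem_preimage, Set.mem_image]
    constructor
    · exact fun ht => ⟨_, ht, rfl⟩
    · rintro ⟨v, hv, hvt⟩
      rwa [← show v = h t from funext fun i => Bool.eq_iff_iff.2 (iff_of_eq (congrFun hvt i))]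
  · rintro ⟨ι, _, h, hh, F, rfl⟩
    classical
    obtain ⟨n, ⟨e⟩⟩ := Finite.exists_equiv_fin ι
    refine ⟨n, fun t i => decide (h t (e.symm i)), ?_, {v | (fun i => v (e i) = true) ∈ F}, ?_⟩
    · rw [isHom_matrixPower_iff]
      simpa using hh.comp_equiv e.symm
    · ext t
      simp

/-! ### Automata on paths -/

theorem isConjFamily_dfa {Q : Type} (M : DFA (PathLetter S ar) Q) :
    IsConjFamily fun (t : RTree S ar) q => ∀ w, IsPathWord t w → M.evalFrom q w ∈ M.accept := by
  intro a q
  refine ⟨∀ h : ar a = 0, M.step q (Sum.inl ⟨a, h⟩) ∈ M.accept,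
    Set.range fun j => (j, M.step q (Sum.inr ⟨a, j⟩)), fun ts => ?_⟩
  rw [Set.forall_mem_range]
  constructor
  · exact fun H => ⟨fun h => H _ (.leaf a h ts), fun j w hw => H _ (.step a ts j w hw)⟩
  · rintro ⟨h0, hs⟩ w hw
    cases hw with
    | leaf _ h _ => exact h0 h
    | step _ _ j w hw => exact hs j w hw

theorem IsUniversalPathLang.conjRecognisable {L : Set (RTree S ar)}
    (hL : IsUniversalPathLang L) : ConjRecognisable L := by
  obtain ⟨W, ⟨Q, hQ, M, hM⟩, rfl⟩ := hL
  refine ⟨Q, hQ, _, isConjFamily_dfa M, {v | v M.start}, ?_⟩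
  ext t
  exact forall₂_congr fun w _ => hM w

theorem BoolComb.conjRecognisable {L : Set (RTree S ar)}
    (hL : BoolComb { M : Set (RTree S ar) | IsUniversalPathLang M } L) :
    ConjRecognisable L := by
  induction hL with
  | base h => exact IsUniversalPathLang.conjRecognisable h
  | compl _ ih =>
    obtain ⟨ι, hι, h, hh, F, rfl⟩ := ih
    exact ⟨ι, hι, h, hh, Fᶜ, rfl⟩
  | union _ _ ih ih' =>
    obtain ⟨ι, hι, h, hh, F, rfl⟩ := ih
    obtain ⟨κ, hκ, g, hg, F', rfl⟩ := ih'
    exact ⟨ι ⊕ κ, inferInstance, _, hh.sum hg, {v | v ∘ Sum.inl ∈ F ∨ v ∘ Sum.inr ∈ F'}, rfl⟩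
  | inter _ _ ih ih' =>
    obtain ⟨ι, hι, h, hh, F, rfl⟩ := ih
    obtain ⟨κ, hκ, g, hg, F', rfl⟩ := ih'
    exact ⟨ι ⊕ κ, inferInstance, _, hh.sum hg, {v | v ∘ Sum.inl ∈ F ∧ v ∘ Sum.inr ∈ F'}, rfl⟩

/-- The deterministic automaton that follows, along a path, the set of coordinates whose
value must be true, and remembers whether all constants met so far were true. -/
def conjDFA (c : S → ι → Prop) (T : (a : S) → ι → Set (Fin (ar a) × ι)) (i : ι) :
    DFA (PathLetter S ar) (Set ι × Prop) where
  step s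
    | Sum.inl a => (∅, s.2 ∧ ∀ i ∈ s.1, c a.1 i)
    | Sum.inr a => ({k | ∃ i ∈ s.1, (a.2, k) ∈ T a.1 i}, s.2 ∧ ∀ i ∈ s.1, c a.1 i)
  start := ({i}, True)
  accept := {s | s.2}

theorem forall_path_conjDFA_iff {c : S → ι → Prop} {T : (a : S) → ι → Set (Fin (ar a) × ι)}
    {h : RTree S ar → ι → Prop}
    (hT : ∀ a i ts, h (RTree.node a ts) i ↔ c a i ∧ ∀ p ∈ T a i, h (ts p.1) p.2)
    (i₀ : ι) (t : RTree S ar) (s : Set ι × Prop) :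
    (∀ w, IsPathWord t w → (conjDFA c T i₀).evalFrom s w ∈ (conjDFA c T i₀).accept) ↔
      s.2 ∧ ∀ i ∈ s.1, h t i := by
  induction t generalizing s with
  | node a ts ih =>
    have hstep : (∀ w, IsPathWord (RTree.node a ts) w →
          (conjDFA c T i₀).evalFrom s w ∈ (conjDFA c T i₀).accept) ↔
        (ar a = 0 → s.2 ∧ ∀ i ∈ s.1, c a i) ∧
          ∀ j, (s.2 ∧ ∀ i ∈ s.1, c a i) ∧ ∀ k, (∃ i ∈ s.1, (j, k) ∈ T a i) → h (ts j) k := by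
      constructor
      · refine fun H => ⟨fun h0 => H _ (.leaf a h0 ts), fun j => ?_⟩
        exact (ih j ((conjDFA c T i₀).step s (Sum.inr ⟨a, j⟩))).1
          fun w hw => H _ (.step a ts j w hw)
      · rintro ⟨h0, hs⟩ w hw
        cases hw with
        | leaf _ h _ => exact h0 h
        | step _ _ j w hw =>
          exact (ih j ((conjDFA c T i₀).step s (Sum.inr ⟨a, j⟩))).2 (hs j) w hw
    rw [hstep]
    simp only [hT]
    constructor
    · rintro ⟨h0, hs⟩
      have hc : s.2 ∧ ∀ i ∈ s.1, c a i := by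
        rcases Nat.eq_zero_or_pos (ar a) with h | h
        · exact h0 h
        · exact (hs ⟨0, h⟩).1
      exact ⟨hc.1, fun i hi => ⟨hc.2 i hi, fun p hp => (hs p.1).2 p.2 ⟨i, hi, hp⟩⟩⟩
    · rintro ⟨hs, H⟩
      have hc : s.2 ∧ ∀ i ∈ s.1, c a i := ⟨hs, fun i hi => (H i hi).1⟩
      exact ⟨fun _ => hc, fun j => ⟨hc, fun k ⟨i, hi, hk⟩ => (H i hi).2 _ hk⟩⟩

theorem IsConjFamily.isUniversalPathLang [Finite ι] {h : RTree S ar → ι → Prop}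
    (hh : IsConjFamily h) (i : ι) : IsUniversalPathLang {t | h t i} := by
  choose c T hT using hh
  refine ⟨{w | w ∈ (conjDFA c T i).accepts},
    ⟨Set ι × Prop, inferInstance, conjDFA c T i, fun w => Iff.rfl⟩, ?_⟩
  ext t
  have key := forall_path_conjDFA_iff hT i t (conjDFA c T i).start
  simp only [conjDFA, Set.mem_singleton_iff, forall_eq, true_and] at key
  exact key.symm

theorem isUniversalPathLang_univ : IsUniversalPathLang (Set.univ : Set (RTree S ar)) := by
  refine ⟨Set.univ, ⟨Unit, inferInstance, ⟨fun _ _ => (), (), Set.univ⟩, fun w => ?_⟩, ?_⟩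
  · simp [DFA.mem_accepts]
  · ext t
    simp [AW]

theorem ConjRecognisable.boolComb {L : Set (RTree S ar)} (hL : ConjRecognisable L) :
    BoolComb { M : Set (RTree S ar) | IsUniversalPathLang M } L := by
  obtain ⟨ι, _, h, hh, F, rfl⟩ := hL
  exact BoolComb.preimage_of_finite h F (BoolComb.empty_of (.base isUniversalPathLang_univ))
    fun i => .base (hh.isUniversalPathLang i)

end Trees

/-- A tree language is recognised by a homomorphism into some matrix
power of the two-element semi-lattice `(2,∧)` if and only if it is a path language,
i.e. a finite Boolean combination of universal path languages. -/
theorem statement10 {S : Type} {ar : S → ℕ} [Finite S] (L : Set (RTree S ar)) :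
    (∃ n : ℕ, Recognises (matrixPower semilatticeAlg n) L) ↔
      BoolComb { M : Set (RTree S ar) | IsUniversalPathLang M } L := by
  rw [exists_recognises_matrixPower_iff]
  exact ⟨ConjRecognisable.boolComb, BoolComb.conjRecognisable⟩
end

section
/- Every finite algebra is isomorphic to a subalgebra of a reduct of some matrix power of the two-element Boolean algebra (2,∨,∧,¬): there exist n ≥ 1, an injective map of the carrier of the algebra into {0,1}^n whose image is closed under suitable operations of (2,∨,∧,¬)^[n], and a choice of operations of (2,∨,∧,¬)^[n] corresponding to the operations of the algebra which make this map an isomorphism of algebras. -/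
set_option autoImplicit false

/-! ## Functional completeness of the Boolean algebra -/

theorem const_mem_Pol {α : Type} (A : AlgStr α) {m : ℕ} (c : α) : (fun _ => c) ∈ Pol A m :=
  ⟨.const c, fun _ => rfl⟩

theorem proj_mem_Pol {α : Type} (A : AlgStr α) {m : ℕ} (i : Fin m) : (fun x => x i) ∈ Pol A m :=
  ⟨.var i, fun _ => rfl⟩

theorem comp_mem_Pol {α : Type} {A : AlgStr α} {m n : ℕ} {f : (Fin n → α) → α} (hf : f ∈ A.ops n)
    {g : Fin n → (Fin m → α) → α} (hg : ∀ j, g j ∈ Pol A m) :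
    (fun x => f fun j => g j x) ∈ Pol A m := by
  choose p hp using hg
  exact ⟨.app n f hf p, fun x => congrArg f (funext fun j => hp j x)⟩

theorem not_mem_Pol_boolAlg {m : ℕ} {g : (Fin m → Bool) → Bool} (hg : g ∈ Pol boolAlg m) :
    (fun x => !g x) ∈ Pol boolAlg m :=
  comp_mem_Pol (A := boolAlg) (n := 1) (f := fun v => !v 0) rfl (g := fun _ => g) fun _ => hg

theorem or_mem_Pol_boolAlg {m : ℕ} {g h : (Fin m → Bool) → Bool} (hg : g ∈ Pol boolAlg m)
    (hh : h ∈ Pol boolAlg m) : (fun x => g x || h x) ∈ Pol boolAlg m :=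
  comp_mem_Pol (A := boolAlg) (n := 2) (f := fun v => v 0 || v 1) (Or.inl rfl) (g := ![g, h])
    (Fin.forall_fin_two.2 ⟨hg, hh⟩)

theorem and_mem_Pol_boolAlg {m : ℕ} {g h : (Fin m → Bool) → Bool} (hg : g ∈ Pol boolAlg m)
    (hh : h ∈ Pol boolAlg m) : (fun x => g x && h x) ∈ Pol boolAlg m :=
  comp_mem_Pol (A := boolAlg) (n := 2) (f := fun v => v 0 && v 1) (Or.inr rfl) (g := ![g, h])
    (Fin.forall_fin_two.2 ⟨hg, hh⟩)

/-- By Shannon expansion, a Boolean function depending only on the variables in `s` is a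
polynomial operation of the Boolean algebra. -/
theorem mem_Pol_boolAlg_of_dependsOn {m : ℕ} (s : Finset (Fin m)) (g : (Fin m → Bool) → Bool)
    (hg : DependsOn g s) : g ∈ Pol boolAlg m := by
  induction s using Finset.induction_on generalizing g with
  | empty =>
    have hconst : g = fun _ => g fun _ => false := funext fun x => hg fun i hi => by simp at hi
    exact hconst ▸ const_mem_Pol boolAlg _
  | insert i s _ ih =>
    have hupd (b : Bool) : (fun x => g (Function.update x i b)) ∈ Pol boolAlg m := by
      refine ih _ fun x y hxy => hg fun j hj => ?_
      obtain rfl | hji := eq_or_ne j i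
      · simp
      · simpa [hji] using hxy j (by simpa [hji] using hj)
    have hexp : g = fun x => (x i && g (Function.update x i true)) ||
        (!x i && g (Function.update x i false)) := by
      funext x
      have hx := congrArg g (Function.update_eq_self i x)
      cases h : x i <;> simp_all
    rw [hexp]
    exact or_mem_Pol_boolAlg (and_mem_Pol_boolAlg (proj_mem_Pol _ i) (hupd true))
      (and_mem_Pol_boolAlg (not_mem_Pol_boolAlg (proj_mem_Pol _ i)) (hupd false))

theorem Pol_boolAlg_eq_univ (m : ℕ) : Pol boolAlg m = Set.univ :=
  Set.eq_univ_of_forall fun g => mem_Pol_boolAlg_of_dependsOn Finset.univ g fun _ _ h =>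
    congrArg g (funext fun i => h i (by simp))

theorem matrixPower_boolAlg_ops_eq_univ (n k : ℕ) :
    (matrixPower boolAlg n).ops k = Set.univ := by
  refine Set.eq_univ_of_forall fun G =>
    ⟨fun i y => G (fun j l => y (finProdFinEquiv (l, j))) i, fun i => ?_, fun as => ?_⟩
  · rw [Pol_boolAlg_eq_univ]
    trivial
  · simp [concatTuples]

/-- Every finite algebra is isomorphic to a subalgebra of a reduct of
some matrix power of the two-element Boolean algebra: there are `n ≥ 1` and an
injective encoding of the carrier into `{0,1}ⁿ` such that every operation of the
algebra is realised, through the encoding, by some operation of `(2,∨,∧,¬)^[n]`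
(so the image is closed under the chosen operations and the encoding is an isomorphism
onto the resulting algebra). -/
theorem statement12 {α : Type} (A : AlgStr α) (hfin : FiniteAlg A) :
    ∃ n : ℕ, 1 ≤ n ∧
      ∃ e : α → (Fin n → Bool), Function.Injective e ∧
        ∀ k : ℕ, ∀ f ∈ A.ops k, ∃ g ∈ (matrixPower boolAlg n).ops k,
          ∀ xs : Fin k → α, g (fun i => e (xs i)) = e (f xs) := by
  have := hfin.1
  let e : α → Fin (Nat.card α + 1) → Bool := fun a i => decide (i = (Finite.equivFin α a).castSucc)
  have he : Function.Injective e := fun a b hab => by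
    have h : e b (Finite.equivFin α a).castSucc = true := by
      rw [← hab]
      simp [e]
    simpa [e] using h
  refine ⟨Nat.card α + 1, Nat.le_add_left 1 _, e, he, fun k f _ => ?_⟩
  refine ⟨Function.extend (fun xs : Fin k → α => fun i => e (xs i)) (fun xs => e (f xs))
    fun _ _ => false, ?_, fun xs => ?_⟩
  · rw [matrixPower_boolAlg_ops_eq_univ]
    trivial
  · exact he.comp_left.extend_apply _ _ xs
end

section
/- (Wreath product principle) Let A and B be algebras and Σ a ranked alphabet. A function f : Trees(Σ) → A×B is a homomorphism into the wreath product A∘B if and only if it is the sequential composition of some homomorphisms h : Trees(Σ) → B and g : Trees(Σ×B) → A, i.e. f(t) = (g(t^h), h(t)) for all t ∈ Trees(Σ). -/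
set_option autoImplicit false

/-- Bottom-up evaluation of trees, given an interpretation of each letter. -/
def RTree.fold {S : Type} {ar : S → ℕ} {α : Type} (op : (a : S) → (Fin (ar a) → α) → α) :
    RTree S ar → α
  | .node a ts => op a (fun i => (ts i).fold op)

theorem RTree.fold_isHom {S : Type} {ar : S → ℕ} {α : Type} (A : AlgStr α)
    (op : (a : S) → (Fin (ar a) → α) → α) (hop : ∀ a, op a ∈ A.ops (ar a)) :
    IsHom A (RTree.fold op) :=
  fun a => ⟨op a, hop a, fun _ => rfl⟩

/-- **wreath product principle.** A function `f : Trees(Σ) → A×B` is a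
homomorphism into the wreath product `A ∘ B` if and only if it is the sequential
composition of homomorphisms `h : Trees(Σ) → B` and `g : Trees(Σ×B) → A`, i.e.
`f t = (g (t^h), h t)` where `t^h` annotates each node with the `h`-value of its
subtree. -/
theorem statement13 {S : Type} {ar : S → ℕ} [Finite S] {α β : Type}
    (A : AlgStr α) (B : AlgStr β) (f : RTree S ar → α × β) :
    IsHom (wreath A B) f ↔
      ∃ (h : RTree S ar → β) (g : RTree (S × β) (fun p => ar p.1) → α),
        IsHom B h ∧ IsHom A g ∧ ∀ t, f t = (g (annotate h t), h t) := by
  constructor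
  · intro hf
    choose F hF hnode using hf
    choose fB hfB am ham hFeq using hF
    have hstep : ∀ (a : S) (ts : Fin (ar a) → RTree S ar), f (RTree.node a ts) =
        (am a (fB a fun i => (f (ts i)).2) (fun i => (f (ts i)).1),
          fB a fun i => (f (ts i)).2) :=
      fun a ts => (hnode a ts).trans (hFeq a _)
    refine ⟨fun t => (f t).2,
      RTree.fold (S := S × β) (ar := fun p => ar p.1) fun p => am p.1 p.2,
      fun a => ⟨fB a, hfB a, fun ts => congrArg Prod.snd (hstep a ts)⟩,
      RTree.fold_isHom A _ fun p => ham p.1 p.2, fun t => ?_⟩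
    induction t with
    | node a ts ih =>
      refine Prod.ext ?_ rfl
      have ih_fst : (fun i => (f (ts i)).1) = _ := funext fun i => congrArg Prod.fst (ih i)
      simp only [annotate, RTree.fold, hstep]
      exact congrArg (am a _) ih_fst
  · rintro ⟨h, g, hh, hg, hf⟩ a
    obtain rfl : f = fun t => (g (annotate h t), h t) := funext hf
    obtain ⟨fB, hfB, hnode⟩ := hh a
    have hg_letter : ∀ b, ∃ k ∈ A.ops (ar a),
        ∀ us : Fin (ar a) → RTree (S × β) (fun p => ar p.1),
          g (RTree.node (a, b) us) = k fun i => g (us i) := fun b => hg (a, b)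
    choose am ham hg_node using hg_letter
    refine ⟨fun xs => (am (fB fun i => (xs i).2) (fun i => (xs i).1), fB fun i => (xs i).2),
      ⟨fB, hfB, am, ham, fun _ => rfl⟩, fun ts => ?_⟩
    simp only [annotate, ← hnode]
    exact Prod.ext (hg_node _ _) rfl
end

section
/- Let f : Trees(Σ) → Trees(Γ) be a tree homomorphism and let g : Trees(Γ) → A be a homomorphism into an algebra A recognising a tree language L ⊆ Trees(Γ). Then the composition g ∘ f : Trees(Σ) → A is a homomorphism into the algebra whose operations are the polynomial (term) operations of A — for each a ∈ Σ the associated operation is the term operation of A obtained by evaluating the defining term t_a of f under g. Consequently, f⁻¹(L) is recognised by an algebra on the same carrier as A all of whose operations are polynomial operations of A; hence for any class of finite algebras closed under polynomial equivalence, the class of tree languages it recognises is closed under inverse images of tree homomorphisms. -/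
set_option autoImplicit false

theorem Pol.var_mem {α : Type} (A : AlgStr α) {m : ℕ} (i : Fin m) :
    (fun xs => xs i) ∈ Pol A m :=
  ⟨.var i, fun _ => rfl⟩

theorem Pol.ops_subset {α : Type} (A : AlgStr α) (n : ℕ) : A.ops n ⊆ Pol A n :=
  fun f hf => ⟨.app n f hf .var, fun _ => rfl⟩

theorem PolyTerm.eval_comp_mem_Pol {α : Type} {A : AlgStr α} {n m : ℕ} (p : PolyTerm A n)
    {as : Fin n → (Fin m → α) → α} (has : ∀ i, as i ∈ Pol A m) :
    (fun xs => p.eval fun i => as i xs) ∈ Pol A m := by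
  induction p with
  | var i => exact has i
  | const c => exact ⟨.const c, fun _ => rfl⟩
  | app k f hf args ih =>
    choose q hq using ih
    exact ⟨.app k f hf q, fun xs => congrArg f (funext fun j => hq j xs)⟩

/-- Polynomial operations are closed under composition. -/
theorem Pol.comp_mem {α : Type} {A : AlgStr α} {n m : ℕ} {f : (Fin n → α) → α}
    (hf : f ∈ Pol A n) {as : Fin n → (Fin m → α) → α} (has : ∀ i, as i ∈ Pol A m) :
    (fun xs => f fun i => as i xs) ∈ Pol A m := by
  obtain ⟨p, hp⟩ := hf
  simpa only [hp] using p.eval_comp_mem_Pol has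

/-- If the basic operations of `B` are polynomial operations of `A`, then so are all
polynomial operations of `B`. -/
theorem Pol.subset_of_ops_subset {α : Type} {A B : AlgStr α}
    (h : ∀ n, B.ops n ⊆ Pol A n) (m : ℕ) : Pol B m ⊆ Pol A m := by
  rintro f ⟨p, hp⟩
  rw [funext hp]
  clear hp
  induction p with
  | var i => exact Pol.var_mem A i
  | const c => exact ⟨.const c, fun _ => rfl⟩
  | app k f hf args ih => exact Pol.comp_mem (h k hf) ih

/-- Evaluating a term under a homomorphism into `A` is a polynomial operation of `A`. -/
theorem IsHom.exists_mem_Pol_subst {G : Type} {arG : G → ℕ} {α : Type} {A : AlgStr α}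
    {g : RTree G arG → α} (hg : IsHom A g) {m : ℕ} (t : TTerm G arG (Fin m)) :
    ∃ f ∈ Pol A m, ∀ σ : Fin m → RTree G arG, g (t.subst σ) = f (fun i => g (σ i)) := by
  induction t with
  | var i => exact ⟨_, Pol.var_mem A i, fun _ => rfl⟩
  | node b ts ih =>
    obtain ⟨f, hf, hgf⟩ := hg b
    choose q hq hgq using ih
    refine ⟨_, Pol.comp_mem (Pol.ops_subset A _ hf) hq, fun σ => ?_⟩
    simp only [TTerm.subst, hgf, hgq]

theorem IsHom.comp_applyTreeHom {S : Type} {ar : S → ℕ} {G : Type} {arG : G → ℕ} {α : Type}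
    {A : AlgStr α} {g : RTree G arG → α} (hg : IsHom A g) (θ : TreeHomData S ar G arG) :
    IsHom (polAlg A) (fun t => g (applyTreeHom θ t)) := by
  intro a
  obtain ⟨f, hf, hgf⟩ := hg.exists_mem_Pol_subst (θ a)
  exact ⟨f, hf, fun ts => hgf _⟩

/-- The algebra obtained from `A` by adding a family of operations. -/
def AlgStr.adjoin {S : Type} {ar : S → ℕ} {α : Type} (A : AlgStr α)
    (q : (a : S) → (Fin (ar a) → α) → α) : AlgStr α where
  ops n := A.ops n ∪
    { f | (⟨n, f⟩ : (n : ℕ) × ((Fin n → α) → α)) ∈ Set.range fun a => ⟨ar a, q a⟩ }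

theorem FiniteAlg.adjoin {S : Type} {ar : S → ℕ} [Finite S] {α : Type} {A : AlgStr α}
    (hA : FiniteAlg A) (q : (a : S) → (Fin (ar a) → α) → α) : FiniteAlg (A.adjoin q) := by
  obtain ⟨hα, hops⟩ := hA
  refine ⟨hα, Finite.of_surjective
    (α := ((n : ℕ) × {f : (Fin n → α) → α // f ∈ A.ops n}) ⊕ S)
    (fun x => match x with
      | .inl y => ⟨y.1, y.2.1, Or.inl y.2.2⟩
      | .inr a => ⟨ar a, q a, Or.inr ⟨a, rfl⟩⟩) ?_⟩
  rintro ⟨n, f, hf | ⟨a, ha⟩⟩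
  · exact ⟨.inl ⟨n, f, hf⟩, rfl⟩
  · cases ha
    exact ⟨.inr a, rfl⟩

theorem Pol.adjoin_eq {S : Type} {ar : S → ℕ} {α : Type} {A : AlgStr α}
    {q : (a : S) → (Fin (ar a) → α) → α} (hq : ∀ a, q a ∈ Pol A (ar a)) (m : ℕ) :
    Pol (A.adjoin q) m = Pol A m := by
  apply Set.Subset.antisymm
  · refine Pol.subset_of_ops_subset (fun n f hf => ?_) m
    rcases hf with hf | ⟨a, ha⟩
    · exact Pol.ops_subset A n hf
    · cases ha
      exact hq a
  · exact Pol.subset_of_ops_subset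
      (fun n f hf => Pol.ops_subset (A.adjoin q) n (Or.inl hf)) m

/-- If `f : Trees(Σ) → Trees(Γ)` is a tree homomorphism and
`g : Trees(Γ) → A` a homomorphism recognising `L`, then `g ∘ f` is a homomorphism into
the algebra of all polynomial (term) operations of `A`; consequently `f⁻¹(L)` is
recognised by an algebra on the same carrier all of whose operations are polynomial
operations of `A`, and for any class of finite algebras closed under polynomial
equivalence, the class of tree languages it recognises is closed under inverse images
of tree homomorphisms. -/
theorem statement16 {S : Type} {ar : S → ℕ} [Finite S] {G : Type} {arG : G → ℕ}
    [Finite G] {α : Type} (A : AlgStr α) (g : RTree G arG → α) (hg : IsHom A g)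
    (θ : TreeHomData S ar G arG) (L : Set (RTree G arG)) (F : Set α)
    (hLF : L = g ⁻¹' F) :
    IsHom (polAlg A) (fun t => g (applyTreeHom θ t)) ∧
    (∃ B : AlgStr α, (∀ n : ℕ, B.ops n ⊆ Pol A n) ∧
      Recognises B (applyTreeHom θ ⁻¹' L)) ∧
    (∀ 𝒞 : ∀ β : Type, AlgStr β → Prop,
      (∀ (β : Type) (B B' : AlgStr β),
        𝒞 β B → FiniteAlg B' → (∀ m : ℕ, Pol B m = Pol B' m) → 𝒞 β B') →
      (∃ (β : Type) (B : AlgStr β), 𝒞 β B ∧ FiniteAlg B ∧ Recognises B L) →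
      ∃ (β : Type) (B' : AlgStr β), 𝒞 β B' ∧ Recognises B' (applyTreeHom θ ⁻¹' L)) := by
  subst hLF
  have hgθ := hg.comp_applyTreeHom θ
  refine ⟨hgθ, ⟨polAlg A, fun _ => subset_rfl, _, hgθ, F, rfl⟩, ?_⟩
  rintro 𝒞 h𝒞 ⟨β, B, hB, hfin, h, hh, E, hE⟩
  choose q hq hhq using hh.comp_applyTreeHom θ
  refine ⟨β, B.adjoin q, h𝒞 β B _ hB (hfin.adjoin q) fun m => (Pol.adjoin_eq hq m).symm,
    fun t => h (applyTreeHom θ t), fun a => ⟨q a, Or.inr ⟨a, rfl⟩, hhq a⟩, E, ?_⟩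
  rw [hE]
  rfl
end
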